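/- (Orbit decomposition.) Let 1 ≤ n ≤ N and let λ, μ, ν ∈ ℤ^n with Σ_s λ_s + Σ_s μ_s − Σ_s ν_s ∈ Nℤ. Then Σ_{I ∈ J_{n,N}} F(I, λ, μ, ν, N) = Σ_{I ∈ J_{n,N}, I_n = 0, I = min(Ω(I,N))} |Ω(I, N)| · F(I, λ, μ, ν, N), where the right-hand sum runs over the tuples I in J_{n,N} with last entry 0 that are the lexicographic minimum of their orbit. -/

import Mathlib

open scoped BigOperators Classical

noncomputable section

/-- The set of pairs `(r,s)` with `r < s` in `Fin n`. -/
def pairsLt (n : ℕ) : Finset (Fin n × Fin n) :=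
  Finset.univ.filter (fun p => p.1 < p.2)

/-- Vandermonde determinant `Δ(x) = ∏_{r<s} (x_r − x_s)` of a complex tuple. -/
def vandC {n : ℕ} (x : Fin n → ℂ) : ℂ := ∏ p ∈ pairsLt n, (x p.1 - x p.2)

/-- `2πi` as a complex number. -/
def twoPiI : ℂ := 2 * (Real.pi : ℂ) * Complex.I

/-- The function `F(I, λ, μ, ν, N)` (with 0-based indexing, so `λ_s + s − 1`
becomes `lam s + s`). -/
def Fdet (n N : ℕ) (I : Fin n → ℝ) (lam mu nu : Fin n → ℤ) : ℂ :=
  (Matrix.of fun r s : Fin n =>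
      Complex.exp (twoPiI * (I r : ℂ) * ((lam s : ℂ) + ((s : ℕ) : ℂ)) / (N : ℂ))).det *
  (Matrix.of fun r s : Fin n =>
      Complex.exp (twoPiI * (I r : ℂ) * ((mu s : ℂ) + ((s : ℕ) : ℂ)) / (N : ℂ))).det *
  (Matrix.of fun r s : Fin n =>
      Complex.exp (-(twoPiI * (I r : ℂ) * ((nu s : ℂ) + ((s : ℕ) : ℂ)) / (N : ℂ)))).det /
  vandC (fun r => Complex.exp (twoPiI * (I r : ℂ) / (N : ℂ)))

/-- `J_{n,N}`: strictly decreasing integer tuples with entries in `{0, …, N−1}`. -/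
def JFinset (n N : ℕ) : Finset (Fin n → ℤ) :=
  (Fintype.piFinset fun _ : Fin n => Finset.Icc (0 : ℤ) ((N : ℤ) - 1)).filter
    (fun I => ∀ r s : Fin n, r < s → I s < I r)

/-- `J` is in the orbit of `I` under the translation action `Φ_N`. -/
def inOrbit (n N : ℕ) (I J : Fin n → ℤ) : Prop :=
  J ∈ JFinset n N ∧
    ∃ l : ℤ, Multiset.map J Finset.univ.val
      = Multiset.map (fun r : Fin n => (I r + l) % (N : ℤ)) Finset.univ.val

/-- Strict lexicographic order on tuples. -/
def LexLt {n : ℕ} (I J : Fin n → ℤ) : Prop :=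
  ∃ r : Fin n, (∀ q : Fin n, q < r → I q = J q) ∧ I r < J r

/-- `I` is the lexicographically smallest element of its orbit. -/
def IsOrbitMin (n N : ℕ) (I : Fin n → ℤ) : Prop :=
  ∀ J : Fin n → ℤ, inOrbit n N I J → J = I ∨ LexLt I J

lemma mem_JFinset_iff {n N : ℕ} {I : Fin n → ℤ} :
    I ∈ JFinset n N ↔ (∀ r, 0 ≤ I r ∧ I r < N) ∧ ∀ r s : Fin n, r < s → I s < I r := by
  simp only [JFinset, Finset.mem_filter, Fintype.mem_piFinset, Finset.mem_Icc, Int.le_sub_one_iff]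

lemma map_univ_val_eq_iff_exists_perm {ι α : Type*} [Fintype ι] {f g : ι → α} :
    Multiset.map f Finset.univ.val = Multiset.map g Finset.univ.val ↔
      ∃ σ : Equiv.Perm ι, ∀ i, f i = g (σ i) := by
  constructor
  · intro h
    have hcard : ∀ c, Fintype.card {i // f i = c} = Fintype.card {i // g i = c} := fun c => by
      have hc := congrArg (Multiset.count c) h
      simp only [Multiset.count_map, ← Finset.filter_val, Finset.card_val] at hc
      simpa only [Fintype.card_subtype, eq_comm] using hc
    let e := fun c => Fintype.equivOfCardEq (hcard c)
    exact ⟨Equiv.ofFiberEquiv e, fun i => (Equiv.ofFiberEquiv_map e i).symm⟩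
  · rintro ⟨σ, hσ⟩
    rw [show f = g ∘ σ from funext hσ, ← Multiset.map_map]
    congr 1
    simp

lemma inOrbit_iff {n N : ℕ} {I J : Fin n → ℤ} :
    inOrbit n N I J ↔ J ∈ JFinset n N ∧
      ∃ (l : ℤ) (σ : Equiv.Perm (Fin n)), ∀ r, J r = (I (σ r) + l) % (N : ℤ) := by
  simp only [inOrbit, map_univ_val_eq_iff_exists_perm]

lemma inOrbit_refl {n N : ℕ} {I : Fin n → ℤ} (hI : I ∈ JFinset n N) : inOrbit n N I I :=
  inOrbit_iff.2 ⟨hI, 0, 1, fun r => by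
    have h := (mem_JFinset_iff.1 hI).1 r
    simp [Int.emod_eq_of_lt h.1 h.2]⟩

lemma inOrbit_symm {n N : ℕ} {I J : Fin n → ℤ} (hI : I ∈ JFinset n N)
    (h : inOrbit n N I J) : inOrbit n N J I := by
  obtain ⟨-, l, σ, hσ⟩ := inOrbit_iff.1 h
  refine inOrbit_iff.2 ⟨hI, -l, σ⁻¹, fun r => ?_⟩
  have h := (mem_JFinset_iff.1 hI).1 r
  rw [hσ, show σ (σ⁻¹ r) = r from σ.apply_symm_apply r, Int.emod_add_emod, add_neg_cancel_right,
    Int.emod_eq_of_lt h.1 h.2]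

lemma inOrbit_trans {n N : ℕ} {I J K : Fin n → ℤ} (h₁ : inOrbit n N I J)
    (h₂ : inOrbit n N J K) : inOrbit n N I K := by
  obtain ⟨-, l, σ, hσ⟩ := inOrbit_iff.1 h₁
  obtain ⟨hK, m, τ, hτ⟩ := inOrbit_iff.1 h₂
  refine inOrbit_iff.2 ⟨hK, l + m, σ * τ, fun r => ?_⟩
  rw [hτ, hσ, Int.emod_add_emod, Equiv.Perm.mul_apply, add_assoc]

lemma lexLt_iff_toLex_lt {n : ℕ} {I J : Fin n → ℤ} : LexLt I J ↔ toLex I < toLex J :=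
  Iff.rfl

lemma exists_isOrbitMin {n N : ℕ} {I : Fin n → ℤ} (hI : I ∈ JFinset n N) :
    ∃ M, inOrbit n N I M ∧ IsOrbitMin n N M := by
  obtain ⟨M, hM, hmin⟩ := Finset.exists_min_image
    ((JFinset n N).filter (inOrbit n N I)) toLex
    ⟨I, Finset.mem_filter.2 ⟨hI, inOrbit_refl hI⟩⟩
  have hIM := (Finset.mem_filter.1 hM).2
  refine ⟨M, hIM, fun J hJ => ?_⟩
  rcases (hmin J (Finset.mem_filter.2 ⟨hJ.1, inOrbit_trans hIM hJ⟩)).eq_or_lt with h | h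
  · exact Or.inl (toLex.injective h).symm
  · exact Or.inr (lexLt_iff_toLex_lt.2 h)

lemma IsOrbitMin.eq_of_inOrbit {n N : ℕ} {M M' : Fin n → ℤ} (hM : IsOrbitMin n N M)
    (hM' : IsOrbitMin n N M') (hmem : M ∈ JFinset n N) (h : inOrbit n N M M') : M' = M := by
  rcases hM M' h with h₁ | h₁
  · exact h₁
  rcases hM' M (inOrbit_symm hmem h) with h₂ | h₂
  · exact h₂.symm
  exact absurd (lexLt_iff_toLex_lt.1 h₁) (lexLt_iff_toLex_lt.1 h₂).asymm

lemma IsOrbitMin.last_eq_zero {n N : ℕ} {M : Fin n → ℤ} (hM : IsOrbitMin n N M)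
    (hmem : M ∈ JFinset n N) (t : Fin n) (ht : (t : ℕ) = n - 1) : M t = 0 := by
  obtain ⟨hb, hdec⟩ := mem_JFinset_iff.1 hmem
  have hle : ∀ r, M t ≤ M r := fun r => by
    rcases (show r ≤ t from Fin.le_def.2 (by omega)).eq_or_lt with h | h
    · rw [h]
    · exact (hdec r t h).le
  have hbt := hb t
  have hb' : ∀ r, 0 ≤ M r - M t ∧ M r - M t < N := fun r => by
    have h₁ := hle r
    have h₂ := hb r
    omega
  have horb : inOrbit n N M (fun r => M r - M t) := inOrbit_iff.2
    ⟨mem_JFinset_iff.2 ⟨hb', fun r s hrs => sub_lt_sub_right (hdec r s hrs) _⟩, -M t, 1,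
      fun r => by
        rw [Equiv.Perm.one_apply, ← sub_eq_add_neg, Int.emod_eq_of_lt (hb' r).1 (hb' r).2]⟩
  rcases hM _ horb with h | ⟨r, -, h⟩
  · have : M t - M t = M t := congrFun h t
    omega
  · have h₁ : M r < M r - M t := h
    omega

/-- The generalized Vandermonde (alternant) determinant `det (x_r ^ a_s)`. -/
def alternant {n : ℕ} (x : Fin n → ℂ) (a : Fin n → ℤ) : ℂ :=
  (Matrix.of fun r s => x r ^ a s).det

lemma alternant_mul_comp_perm {n : ℕ} (x : Fin n → ℂ) (a : Fin n → ℤ) {c : ℂ} (hc : c ≠ 0)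
    (σ : Equiv.Perm (Fin n)) :
    alternant (fun r => c * x (σ r)) a = c ^ (∑ s, a s) * ((σ.sign : ℤ) * alternant x a) := by
  have hprod : ∏ s, c ^ a s = c ^ ∑ s, a s := by
    induction (Finset.univ : Finset (Fin n)) using Finset.induction_on with
    | empty => simp
    | insert i s hi ih => rw [Finset.prod_insert hi, Finset.sum_insert hi, zpow_add₀ hc, ih]
  unfold alternant
  rw [← hprod, ← Matrix.det_permute, ← Matrix.det_mul_row]
  congr 1
  ext r s
  simp [mul_zpow]

lemma vandC_eq_alternant {n : ℕ} (x : Fin n → ℂ) :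
    vandC x = alternant (fun r => -x r) (fun s => ((s : ℕ) : ℤ)) := by
  have h : alternant (fun r => -x r) (fun s => ((s : ℕ) : ℤ))
      = (Matrix.vandermonde fun r => -x r).det := by
    simp [alternant, Matrix.vandermonde]
  rw [h, Matrix.det_vandermonde, vandC, pairsLt, Finset.prod_filter, ← Finset.univ_product_univ,
    Finset.prod_product]
  refine Finset.prod_congr rfl fun i _ => ?_
  rw [← Finset.prod_filter]
  refine Finset.prod_congr (by ext; simp) fun j _ => by ring

lemma Fdet_eq_alternant {n N : ℕ} (I : Fin n → ℤ) (lam mu nu : Fin n → ℤ) :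
    let x : Fin n → ℂ := fun r => Complex.exp (twoPiI * (I r : ℂ) / (N : ℂ))
    Fdet n N (fun r => (I r : ℝ)) lam mu nu =
      alternant x (fun s => lam s + (s : ℕ)) * alternant x (fun s => mu s + (s : ℕ)) *
        alternant x (fun s => -(nu s + (s : ℕ))) / alternant (fun r => -x r) (fun s => (s : ℕ)) := by
  intro x
  simp only [Fdet, Complex.ofReal_intCast]
  rw [vandC_eq_alternant]
  congr 1
  unfold alternant
  congr 1
  · congr 1 <;>
    · congr 1
      ext r s
      simp only [Matrix.of_apply, x, ← Complex.exp_int_mul]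
      congr 1
      push_cast
      ring
  · congr 1
    ext r s
    simp only [Matrix.of_apply, x, ← Complex.exp_int_mul]
    congr 1
    push_cast
    ring

lemma exp_twoPiI_emod {N : ℕ} (hN : N ≠ 0) (m : ℤ) :
    Complex.exp (twoPiI * ((m % (N : ℤ) : ℤ) : ℂ) / N) = Complex.exp (twoPiI * (m : ℂ) / N) := by
  have hN' : (N : ℂ) ≠ 0 := Nat.cast_ne_zero.2 hN
  rw [Complex.exp_eq_exp_iff_exists_int]
  refine ⟨-(m / N), ?_⟩
  rw [Int.emod_def]
  unfold twoPiI
  push_cast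
  field_simp
  ring

lemma scaled_mul_div_eq {K : Type*} [Field K] {p q t e : K} (hp : p ≠ 0) (hq : q ≠ 0)
    (ht : t ≠ 0) (he : e * e = 1) (A B C D : K) :
    p * (e * A) * (q * (e * B)) * (t * (e * C)) / (p * q * t * (e * D)) = A * B * C / D := by
  have hne : p * q * t * e ≠ 0 :=
    mul_ne_zero (mul_ne_zero (mul_ne_zero hp hq) ht) (left_ne_zero_of_mul_eq_one he)
  have hnum : p * (e * A) * (q * (e * B)) * (t * (e * C)) = p * q * t * e * (A * B * C) := by
    linear_combination (p * q * t * e * (A * B * C)) * he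
  rw [hnum, ← mul_assoc _ e D, mul_div_mul_left _ _ hne]

lemma Fdet_eq_of_inOrbit {n N : ℕ} (hN : N ≠ 0) {lam mu nu : Fin n → ℤ}
    (hsum : ∃ k : ℤ, ∑ s, lam s + ∑ s, mu s - ∑ s, nu s = k * N) {I J : Fin n → ℤ}
    (h : inOrbit n N I J) :
    Fdet n N (fun r => (J r : ℝ)) lam mu nu = Fdet n N (fun r => (I r : ℝ)) lam mu nu := by
  obtain ⟨k, hk⟩ := hsum
  obtain ⟨-, l, σ, hσ⟩ := inOrbit_iff.1 h
  have hN' : (N : ℂ) ≠ 0 := Nat.cast_ne_zero.2 hN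
  set c : ℂ := Complex.exp (twoPiI * (l : ℂ) / N) with hcdef
  have hc : c ≠ 0 := Complex.exp_ne_zero _
  have hcN : c ^ (k * (N : ℤ)) = 1 := by
    rw [hcdef, ← Complex.exp_int_mul, Complex.exp_eq_one_iff]
    refine ⟨k * l, ?_⟩
    unfold twoPiI
    push_cast
    field_simp
  have hx : ∀ r, Complex.exp (twoPiI * (J r : ℂ) / N) =
      c * Complex.exp (twoPiI * (I (σ r) : ℂ) / N) := fun r => by
    rw [hσ, exp_twoPiI_emod hN, hcdef, ← Complex.exp_add]
    congr 1
    push_cast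
    ring
  have hpow : c ^ (∑ s, (lam s + (s : ℕ))) * c ^ (∑ s, (mu s + (s : ℕ))) *
      c ^ (∑ s, -(nu s + (s : ℕ))) = c ^ (∑ s : Fin n, ((s : ℕ) : ℤ)) := by
    rw [← zpow_add₀ hc, ← zpow_add₀ hc, ← one_mul (c ^ (∑ s : Fin n, ((s : ℕ) : ℤ))), ← hcN,
      ← zpow_add₀ hc, ← hk]
    congr 1
    simp only [Finset.sum_add_distrib, Finset.sum_neg_distrib]
    ring
  rw [Fdet_eq_alternant, Fdet_eq_alternant]
  simp only [hx]
  simp only [← mul_neg]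
  set x : Fin n → ℂ := fun r => Complex.exp (twoPiI * (I r : ℂ) / N) with hxdef
  have key := fun a => alternant_mul_comp_perm x a hc σ
  have key' := fun a => alternant_mul_comp_perm (fun r => -x r) a hc σ
  simp only [hxdef] at key key'
  rw [key, key, key, key', ← hpow]
  have hsign : ((σ.sign : ℤ) : ℂ) * (σ.sign : ℤ) = 1 := by
    rw [← Int.cast_mul, ← Units.val_mul, Int.units_mul_self, Units.val_one, Int.cast_one]
  exact scaled_mul_div_eq (zpow_ne_zero _ hc) (zpow_ne_zero _ hc) (zpow_ne_zero _ hc) hsign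
    _ _ _ _

/-- **Orbit decomposition.** -/
theorem statement7 (n N : ℕ) (hn : 1 ≤ n) (hnN : n ≤ N)
    (lam mu nu : Fin n → ℤ)
    (hsum : ∃ k : ℤ, ∑ s, lam s + ∑ s, mu s - ∑ s, nu s = k * N) :
    ∑ I ∈ JFinset n N, Fdet n N (fun r => (I r : ℝ)) lam mu nu
      = ∑ I ∈ (JFinset n N).filter
            (fun I => (∀ r : Fin n, (r : ℕ) = n - 1 → I r = 0) ∧ IsOrbitMin n N I),
          (Set.ncard {J : Fin n → ℤ | inOrbit n N I J} : ℂ) *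
            Fdet n N (fun r => (I r : ℝ)) lam mu nu := by
  choose! g hg hmin using fun I => exists_isOrbitMin (n := n) (N := N) (I := I)
  have hmaps : ∀ I ∈ JFinset n N, g I ∈ (JFinset n N).filter
      (fun I => (∀ r : Fin n, (r : ℕ) = n - 1 → I r = 0) ∧ IsOrbitMin n N I) := fun I hI =>
    Finset.mem_filter.2 ⟨(hg I hI).1, (hmin I hI).last_eq_zero (hg I hI).1, hmin I hI⟩
  rw [← Finset.sum_fiberwise_of_maps_to (g := g) hmaps]
  refine Finset.sum_congr rfl fun M hM => ?_
  obtain ⟨hMJ, -, hMmin⟩ := Finset.mem_filter.1 hM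
  have hfib : ∀ J, J ∈ (JFinset n N).filter (fun J => g J = M) ↔ inOrbit n N M J := fun J => by
    rw [Finset.mem_filter]
    constructor
    · rintro ⟨hJ, rfl⟩
      exact inOrbit_symm hJ (hg J hJ)
    · exact fun h => ⟨h.1, hMmin.eq_of_inOrbit (hmin J h.1) hMJ (inOrbit_trans h (hg J h.1))⟩
  have hset : {J : Fin n → ℤ | inOrbit n N M J} =
      ((JFinset n N).filter (fun J => g J = M) : Finset (Fin n → ℤ)) :=
    Set.ext fun J => (hfib J).symm
  rw [hset, Set.ncard_coe_finset, Finset.sum_congr rfl fun J hJ =>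
    Fdet_eq_of_inOrbit (by omega) hsum ((hfib J).1 hJ), Finset.sum_const, nsmul_eq_mul]
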